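/- Let G = N ⋊ ℤ, where N is a finitely generated abelian group and a fixed generator of ℤ acts on N by a group automorphism. Make ℚ ⊗_ℤ N a ℚ[x]-module by letting x act via this automorphism, and let d be the minimal number of generators of ℚ ⊗_ℤ N as a ℚ[x]-module. Then mdeg(G) = d. -/

import Mathlib

open Polynomial TensorProduct

/-- The number of maximal subgroups of `G` of index `n`. -/
noncomputable def maxSubgroupCount (G : Type*) [Group G] (n : ℕ) : ℕ :=
  Nat.card {H : Subgroup G // IsCoatom H ∧ H.index = n}

/-- `mdeg G`, the degree of maximal subgroup growth of `G`:
`limsup (log m_n(G) / log n)`. -/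
noncomputable def mdeg (G : Type*) [Group G] : ℝ :=
  Filter.atTop.limsup fun n : ℕ => Real.log (maxSubgroupCount G n) / Real.log n

/-- The semidirect product `N ⋊ ℤ` in which a fixed generator of `ℤ` acts on the
abelian group `N` via the automorphism `θ`. -/
abbrev abelianByZ (N : Type*) [AddCommGroup N] (θ : N ≃+ N) : Type _ :=
  SemidirectProduct (Multiplicative N) (Multiplicative ℤ)
    (zpowersHom (MulAut (Multiplicative N)) (AddEquiv.toMultiplicative θ))

/-- The element `n` of the normal factor `N`, viewed in `N ⋊ ℤ`. -/
def AbelianByZ.incl {N : Type*} [AddCommGroup N] (θ : N ≃+ N) (n : N) : abelianByZ N θ :=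
  SemidirectProduct.inl (Multiplicative.ofAdd n)

/-- The fixed generator of the factor `ℤ`, viewed in `N ⋊ ℤ`. -/
def AbelianByZ.gen {N : Type*} [AddCommGroup N] (θ : N ≃+ N) : abelianByZ N θ :=
  SemidirectProduct.inr (Multiplicative.ofAdd 1)

namespace AbelianByZ

section Group

variable {N : Type*} [AddCommGroup N] (θ : N ≃+ N)

theorem incl_zero : incl θ 0 = 1 := map_one _

theorem incl_add (m n : N) : incl θ (m + n) = incl θ m * incl θ n := map_mul _ _ _

theorem incl_neg (n : N) : incl θ (-n) = (incl θ n)⁻¹ := map_inv _ _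

theorem rightHom_incl (n : N) : SemidirectProduct.rightHom (incl θ n) = 1 :=
  SemidirectProduct.rightHom_inl _

theorem rightHom_gen : SemidirectProduct.rightHom (gen θ) = Multiplicative.ofAdd 1 :=
  SemidirectProduct.rightHom_inr _

theorem rightHom_incl_mul_gen (a : N) :
    SemidirectProduct.rightHom (incl θ a * gen θ) = Multiplicative.ofAdd 1 := by
  rw [map_mul, rightHom_incl, rightHom_gen, one_mul]

variable {θ}

theorem exists_eq_incl {g : abelianByZ N θ} (hg : SemidirectProduct.rightHom g = 1) :
    ∃ n, g = incl θ n := by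
  have : g ∈ (SemidirectProduct.inl : _ →* abelianByZ N θ).range := by
    rw [SemidirectProduct.range_inl_eq_ker_rightHom]; exact hg
  obtain ⟨n, rfl⟩ := this
  exact ⟨n.toAdd, rfl⟩

theorem exists_eq_incl_mul {g h : abelianByZ N θ}
    (hg : SemidirectProduct.rightHom g = SemidirectProduct.rightHom h) :
    ∃ n, g = incl θ n * h := by
  obtain ⟨n, hn⟩ := exists_eq_incl (g := g * h⁻¹) (by rw [map_mul, map_inv, hg, mul_inv_cancel])
  exact ⟨n, by rw [← hn]; group⟩

theorem gen_conj (n : N) : gen θ * incl θ n * (gen θ)⁻¹ = incl θ (θ n) := by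
  rw [gen, incl, ← map_inv, ← SemidirectProduct.inl_aut]
  simp [incl]

theorem conj_incl {g : abelianByZ N θ}
    (hg : SemidirectProduct.rightHom g = Multiplicative.ofAdd 1) (n : N) :
    g * incl θ n * g⁻¹ = incl θ (θ n) := by
  obtain ⟨a, rfl⟩ := exists_eq_incl_mul (hg.trans (rightHom_gen θ).symm)
  calc incl θ a * gen θ * incl θ n * (incl θ a * gen θ)⁻¹
      = incl θ a * (gen θ * incl θ n * (gen θ)⁻¹) * (incl θ a)⁻¹ := by group
    _ = incl θ (θ n) := by
      rw [gen_conj, ← incl_neg, ← incl_add, ← incl_add]; congr 1; abel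

theorem zpow_rightHom {g : abelianByZ N θ}
    (hg : SemidirectProduct.rightHom g = Multiplicative.ofAdd 1) (h : abelianByZ N θ) :
    ∃ k : ℤ, ∃ n, h = incl θ n * g ^ k := by
  refine ⟨(SemidirectProduct.rightHom h).toAdd, exists_eq_incl_mul ?_⟩
  rw [map_zpow, hg, ← ofAdd_zsmul]
  simp

/-- A subgroup is determined by its intersection with `N` and an element over the generator. -/
theorem le_of_incl_mem {M M' : Subgroup (abelianByZ N θ)}
    (hN : ∀ n, incl θ n ∈ M → incl θ n ∈ M') {a : N}
    (ha : incl θ a * gen θ ∈ M) (ha' : incl θ a * gen θ ∈ M') : M ≤ M' := by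
  intro h hh
  obtain ⟨k, n, rfl⟩ := zpow_rightHom (rightHom_incl_mul_gen θ a) h
  exact M'.mul_mem (hN n ((M.mul_mem_cancel_right (M.zpow_mem ha k)).1 hh)) (M'.zpow_mem ha' k)

theorem eq_of_range_le {M M' : Subgroup (abelianByZ N θ)} (hM : ∀ n, incl θ n ∈ M)
    (hM' : ∀ n, incl θ n ∈ M') (h0 : M.index ≠ 0) (h : M.index = M'.index) : M = M' := by
  have key : ∀ L : Subgroup (abelianByZ N θ), (∀ n, incl θ n ∈ L) → L.index = M.index →
      L = (Subgroup.zpowers (Multiplicative.ofAdd (M.index : ℤ))).comap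
        SemidirectProduct.rightHom := by
    intro L hL hLi
    have hs : Function.Surjective (SemidirectProduct.rightHom : abelianByZ N θ →* _) :=
      SemidirectProduct.rightHom_surjective
    have hker : (SemidirectProduct.rightHom : abelianByZ N θ →* _).ker ≤ L := by
      intro g hg
      obtain ⟨n, rfl⟩ := exists_eq_incl hg
      exact hL n
    have h1 : (L.map SemidirectProduct.rightHom).index = M.index := by
      rw [Subgroup.index_map_eq _ hs hker, hLi]
    have h2 : Subgroup.zpowers (Multiplicative.ofAdd (M.index : ℤ)) ≤
        L.map SemidirectProduct.rightHom := by
      rw [Subgroup.zpowers_le]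
      have := Subgroup.pow_index_mem (L.map (SemidirectProduct.rightHom : abelianByZ N θ →* _))
        (Multiplicative.ofAdd 1)
      rw [h1, ← ofAdd_nsmul] at this
      simpa using this
    have h3 : (Subgroup.zpowers (Multiplicative.ofAdd (M.index : ℤ))).index = M.index := by
      exact (AddSubgroup.index_toSubgroup (AddSubgroup.zmultiples (M.index : ℤ))).trans
        (Int.index_zmultiples _)
    rw [← Subgroup.comap_map_eq_self hker]
    congr 1
    symm
    refine le_antisymm h2 (Subgroup.relIndex_eq_one.1 ?_)
    have := Subgroup.relIndex_mul_index h2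
    rw [h1, h3] at this
    exact Nat.eq_of_mul_eq_mul_right (Nat.pos_of_ne_zero h0) (by simpa using this)
  rw [key M hM rfl, ← key M' hM' h.symm]

theorem card_quotient_eq_index {M : Subgroup (abelianByZ N θ)} {K : AddSubgroup N}
    (hK : ∀ n, incl θ n ∈ M ↔ n ∈ K) (hM : ∀ g, ∃ n, ∃ m ∈ M, g = incl θ n * m) :
    Nat.card (N ⧸ K) = M.index := by
  refine Nat.card_congr (Equiv.ofBijective (Quotient.map' (incl θ) ?_) ⟨?_, ?_⟩)
  · intro a b h
    rw [QuotientAddGroup.leftRel_apply] at h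
    rw [QuotientGroup.leftRel_apply, ← incl_neg, ← incl_add]
    exact (hK _).2 h
  · rintro ⟨a⟩ ⟨b⟩ h
    refine Quotient.sound' ?_
    have := Quotient.exact' h
    rw [QuotientGroup.leftRel_apply, ← incl_neg, ← incl_add, hK] at this
    rwa [QuotientAddGroup.leftRel_apply]
  · rintro ⟨g⟩
    obtain ⟨n, m, hm, rfl⟩ := hM g
    refine ⟨Quotient.mk'' n, Quotient.sound' ?_⟩
    rw [QuotientGroup.leftRel_apply]
    simpa using hm

end Group

section Module

variable {N : Type*} [AddCommGroup N] [Module ℤ[X] N] {θ : N ≃+ N}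

theorem exists_smul_X_smul_eq (hX : ∀ n : N, (X : ℤ[X]) • n = θ n) [Module.Finite ℤ[X] N] :
    ∃ g : ℤ[X], ∀ n : N, g • (X : ℤ[X]) • n = n := by
  obtain ⟨r, hr, h⟩ := Submodule.exists_sub_one_mem_and_smul_eq_zero_of_fg_of_le_smul
    (Ideal.span {(X : ℤ[X])}) (⊤ : Submodule ℤ[X] N) Module.Finite.fg_top (by
      intro n _
      rw [← θ.apply_symm_apply n, ← hX]
      exact Submodule.smul_mem_smul (Ideal.mem_span_singleton_self _) trivial)
  obtain ⟨f, hf⟩ := Ideal.mem_span_singleton'.1 hr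
  refine ⟨-f, fun n => ?_⟩
  have := h n trivial
  rw [sub_eq_iff_eq_add.1 hf.symm, add_smul, one_smul, mul_smul] at this
  rw [neg_smul]
  exact (eq_neg_of_add_eq_zero_right this).symm

theorem exists_inl_mul_mem {M : Subgroup (abelianByZ N θ)} (hM : IsCoatom M)
    {L : Submodule ℤ[X] N} (hX : ∀ n : N, (X : ℤ[X]) • n = θ n) [Module.Finite ℤ[X] N]
    {l : N} (hl : l ∈ L) (hlM : incl θ l ∉ M) (h : abelianByZ N θ) :
    ∃ n ∈ L, ∃ m ∈ M, h = incl θ n * m := by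
  obtain ⟨f, hf⟩ := exists_smul_X_smul_eq hX
  have hsymm : ∀ n ∈ L, θ.symm n ∈ L := by
    intro n hn
    have := hf (θ.symm n)
    rw [hX, θ.apply_symm_apply] at this
    rw [← this]
    exact L.smul_mem _ hn
  let H : Subgroup (abelianByZ N θ) :=
    L.toAddSubgroup.toSubgroup.map (SemidirectProduct.inl : Multiplicative N →* abelianByZ N θ)
  have hH : ∀ n ∈ L, incl θ n ∈ H := fun n hn => ⟨Multiplicative.ofAdd n, hn, rfl⟩
  have hH' : ∀ g ∈ H, ∃ n ∈ L, g = incl θ n := by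
    rintro _ ⟨n, hn, rfl⟩
    exact ⟨n.toAdd, hn, rfl⟩
  have hconj : ∀ n ∈ L, gen θ * incl θ n * (gen θ)⁻¹ ∈ H := by
    intro n hn
    rw [gen_conj, ← hX]
    exact hH _ (L.smul_mem _ hn)
  have hconj' : ∀ n ∈ L, (gen θ)⁻¹ * incl θ n * gen θ ∈ H := by
    intro n hn
    rw [show (gen θ)⁻¹ * incl θ n * gen θ = incl θ (θ.symm n) by
      have := gen_conj (θ := θ) (θ.symm n)
      rw [θ.apply_symm_apply] at this
      rw [← this]; group]
    exact hH _ (hsymm n hn)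
  have hgen : gen θ ∈ Subgroup.normalizer (H : Set (abelianByZ N θ)) := by
    rw [Subgroup.mem_normalizer_iff]
    intro g
    constructor
    · intro hg
      obtain ⟨n, hn, rfl⟩ := hH' g hg
      exact hconj n hn
    · intro hg
      obtain ⟨n, hn, h⟩ := hH' _ hg
      rw [show g = (gen θ)⁻¹ * incl θ n * gen θ by rw [← h]; group]
      exact hconj' n hn
  have hinc : ∀ n, incl θ n ∈ Subgroup.normalizer (H : Set (abelianByZ N θ)) := by
    intro n
    rw [Subgroup.mem_normalizer_iff]
    have comm : ∀ m, incl θ n * incl θ m * (incl θ n)⁻¹ = incl θ m := by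
      intro m; rw [← incl_neg, ← incl_add, ← incl_add]; congr 1; abel
    intro g
    constructor
    · intro hg
      obtain ⟨m, hm, rfl⟩ := hH' g hg
      rwa [comm]
    · intro hg
      obtain ⟨m, hm, h⟩ := hH' _ hg
      rw [show g = incl θ (-n) * incl θ m * incl θ n by rw [← h, incl_neg]; group, ← incl_add,
        ← incl_add]
      simpa using hH m hm
  have hnormal : H.Normal := by
    rw [← Subgroup.normalizer_eq_top_iff, eq_top_iff]
    intro g _
    obtain ⟨k, n, rfl⟩ := zpow_rightHom (rightHom_gen θ) g
    exact mul_mem (hinc n) (zpow_mem hgen k)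
  have htop : H ⊔ M = ⊤ := by
    refine hM.2 _ (lt_of_le_of_ne le_sup_right fun h => hlM ?_)
    rw [h]
    exact (le_sup_left : H ≤ H ⊔ M) (hH l hl)
  have := Subgroup.normal_mul H M
  rw [htop] at this
  have hh : h ∈ ((⊤ : Subgroup (abelianByZ N θ)) : Set _) := trivial
  rw [this] at hh
  obtain ⟨g, hg, m, hm, rfl⟩ := hh
  obtain ⟨n, hn, rfl⟩ := hH' g hg
  exact ⟨n, hn, m, hm, rfl⟩

theorem exists_submodule_inter (hX : ∀ n : N, (X : ℤ[X]) • n = θ n)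
    {M : Subgroup (abelianByZ N θ)} {a : N} (ham : incl θ a * gen θ ∈ M) :
    ∃ K : Submodule ℤ[X] N, ∀ n, incl θ n ∈ M ↔ n ∈ K := by
  let K₀ : AddSubgroup N :=
    { carrier := {n | incl θ n ∈ M}
      zero_mem' := by simp only [Set.mem_ofPred_eq, incl_zero]; exact M.one_mem
      add_mem' := fun {x y} hx hy => by
        simp only [Set.mem_ofPred_eq, incl_add] at *; exact M.mul_mem hx hy
      neg_mem' := fun {x} hx => by
        simp only [Set.mem_ofPred_eq, incl_neg] at *; exact M.inv_mem hx }
  have hXK : ∀ n ∈ K₀, (X : ℤ[X]) • n ∈ K₀ := by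
    intro n hn
    rw [hX]
    change incl θ (θ n) ∈ M
    rw [← conj_incl (rightHom_incl_mul_gen θ a) n]
    exact M.mul_mem (M.mul_mem ham hn) (M.inv_mem ham)
  let K : Submodule ℤ[X] N :=
    { K₀ with
      smul_mem' := by
        intro f n hn
        change f • n ∈ K₀
        replace hn : n ∈ K₀ := hn
        induction f using Polynomial.induction_on with
        | C c =>
          rw [show (C c : ℤ[X]) = (c : ℤ[X]) from Polynomial.C_eq_intCast c, Int.cast_smul_eq_zsmul]
          exact K₀.zsmul_mem hn c
        | add f g hf hg => rw [add_smul]; exact K₀.add_mem hf hg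
        | monomial k c h =>
          rw [pow_succ', ← mul_assoc, mul_comm _ X, mul_assoc, mul_smul]
          exact hXK _ h }
  exact ⟨K, fun n => Iff.rfl⟩

/-- A maximal subgroup not containing `N` meets `N` in a maximal submodule. -/
theorem exists_submodule_of_isCoatom (hX : ∀ n : N, (X : ℤ[X]) • n = θ n) [Module.Finite ℤ[X] N]
    {M : Subgroup (abelianByZ N θ)} (hM : IsCoatom M) (hN : ∃ n, incl θ n ∉ M) :
    ∃ (K : Submodule ℤ[X] N) (a : N), IsCoatom K ∧ (∀ n, incl θ n ∈ M ↔ n ∈ K) ∧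
      incl θ a * gen θ ∈ M ∧ Nat.card (N ⧸ K) = M.index := by
  obtain ⟨n₀, hn₀⟩ := hN
  have hfact := exists_inl_mul_mem hM hX (L := ⊤) (l := n₀) trivial hn₀
  obtain ⟨a, -, m, hm, ha⟩ := hfact (gen θ)
  have ham : incl θ (-a) * gen θ ∈ M := by
    rw [ha, incl_neg, inv_mul_cancel_left]; exact hm
  obtain ⟨K, hK⟩ := exists_submodule_inter hX ham
  refine ⟨K, -a, ⟨?_, ?_⟩, hK, ham, ?_⟩
  · intro h
    exact hn₀ ((hK n₀).2 (h ▸ trivial))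
  · intro L hKL
    obtain ⟨l, hl, hlK⟩ := SetLike.exists_of_lt hKL
    rw [eq_top_iff]
    intro n _
    obtain ⟨n', hn', m', hm', h⟩ := exists_inl_mul_mem hM hX hl (fun h => hlK ((hK l).1 h))
      (incl θ n)
    have : n - n' ∈ K := by
      rw [← hK, sub_eq_add_neg, add_comm, incl_add, incl_neg, h, inv_mul_cancel_left]
      exact hm'
    simpa using L.add_mem (hKL.le this) hn'
  · exact card_quotient_eq_index (K := K.toAddSubgroup) hK fun g => by
      obtain ⟨n, -, h⟩ := hfact g
      exact ⟨n, h⟩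

/-- The stabilizer of `0` in the affine action of `N ⋊ ℤ` on a simple quotient of `N`. -/
theorem exists_isCoatom_of_surjective (hX : ∀ n : N, (X : ℤ[X]) • n = θ n)
    [Module.Finite ℤ[X] N] {S : Type*} [AddCommGroup S] [Module ℤ[X] S] [IsSimpleModule ℤ[X] S]
    (ψ : N →ₗ[ℤ[X]] S) (hψ : Function.Surjective ψ) (b : S) :
    ∃ M : Subgroup (abelianByZ N θ), IsCoatom M ∧ M.index = Nat.card S ∧
      (∀ n, incl θ n ∈ M ↔ ψ n = 0) ∧ ∀ n, incl θ n * gen θ ∈ M ↔ ψ n + b = 0 := by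
  obtain ⟨f, hf⟩ := exists_smul_X_smul_eq hX
  have hfS : ∀ s : S, f • (X : ℤ[X]) • s = s := by
    intro s
    obtain ⟨n, rfl⟩ := hψ s
    rw [← map_smul, ← map_smul, hf]
  let τ : Equiv.Perm S :=
    { toFun := fun y => (X : ℤ[X]) • y + b
      invFun := fun y => f • (y - b)
      left_inv := fun y => by simp [hfS]
      right_inv := fun y => by simp only [smul_comm _ f, hfS]; abel }
  let tr : Multiplicative N →* Equiv.Perm S :=
    { toFun := fun n => Equiv.addLeft (ψ n.toAdd)
      map_one' := by ext; simp
      map_mul' := fun m n => by ext; simp }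
  have hτ : ∀ n : N, tr (Multiplicative.ofAdd (θ n)) * τ = τ * tr (Multiplicative.ofAdd n) := by
    intro n
    ext y
    simp [tr, τ, ← hX, add_assoc]
  let ρ : abelianByZ N θ →* Equiv.Perm S := SemidirectProduct.lift tr (zpowersHom _ τ) (by
    have : ∀ g : Multiplicative ℤ, g ∈ Subgroup.zpowers (Multiplicative.ofAdd (1 : ℤ)) := fun g =>
      ⟨g.toAdd, by simp [← ofAdd_zsmul]⟩
    intro g
    refine MonoidHom.ext fun n => ?_
    have hg := this g
    simp only [MonoidHom.comp_apply, MulEquiv.coe_toMonoidHom, MulAut.conj_apply]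
    rw [Subgroup.zpowers_eq_closure] at hg
    induction hg using Subgroup.closure_induction generalizing n with
    | mem x hx =>
      rw [Set.mem_singleton_iff.1 hx, zpowersHom_apply, zpowersHom_apply]
      simpa using eq_mul_inv_of_mul_eq (hτ n.toAdd)
    | one => simp
    | mul x y _ _ hx hy => rw [map_mul, MulAut.mul_apply, hx, hy, map_mul]; group
    | inv x _ hx =>
      have := hx (((zpowersHom (MulAut (Multiplicative N))) (AddEquiv.toMultiplicative θ) x)⁻¹ n)
      rw [MulAut.apply_inv_self] at this
      rw [map_inv, this, map_inv]; group)
  have hρi : ∀ n y, ρ (incl θ n) y = ψ n + y := by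
    intro n y; simp [ρ, incl, tr]
  have hρg : ∀ y, ρ (gen θ) y = (X : ℤ[X]) • y + b := by
    intro y; simp [ρ, gen, τ]
  let M : Subgroup (abelianByZ N θ) := (MulAction.stabilizer (Equiv.Perm S) (0 : S)).comap ρ
  have hM : ∀ g, g ∈ M ↔ ρ g 0 = 0 := fun g => Iff.rfl
  have hMi : ∀ n, incl θ n ∈ M ↔ ψ n = 0 := by
    intro n; rw [hM, hρi, add_zero]
  have hfact : ∀ g, ∃ n, incl θ (-n) * g ∈ M ∧ ψ n = ρ g 0 := by
    intro g
    obtain ⟨n, hn⟩ := hψ (ρ g 0)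
    exact ⟨n, by rw [hM, map_mul, Equiv.Perm.mul_apply, hρi, map_neg, hn, neg_add_cancel], hn⟩
  have := IsSimpleModule.nontrivial ℤ[X] S
  have hne : M ≠ ⊤ := by
    intro h
    obtain ⟨s, hs⟩ := exists_ne (0 : S)
    obtain ⟨n, rfl⟩ := hψ s
    exact hs ((hMi n).1 (h ▸ trivial))
  refine ⟨M, ⟨hne, ?_⟩, ?_, hMi, ?_⟩
  · intro H hMH
    obtain ⟨h, hhH, hhM⟩ := SetLike.exists_of_lt hMH
    obtain ⟨a, ha, -⟩ := hfact (gen θ)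
    obtain ⟨L, hL⟩ := exists_submodule_inter hX (hMH.le ha)
    have hker : IsCoatom ψ.ker := by
      rw [← isSimpleModule_iff_isCoatom]
      exact IsSimpleModule.congr (ψ.quotKerEquivOfSurjective hψ)
    have hLtop : L = ⊤ := by
      refine hker.2 _ (SetLike.lt_iff_le_and_exists.2 ⟨fun n hn => ?_, ?_⟩)
      · exact (hL n).1 (hMH.le ((hMi n).2 hn))
      · obtain ⟨n, hn, -⟩ := hfact h
        refine ⟨n, (hL n).1 ?_, fun hnψ => hhM ?_⟩
        · have := H.mul_mem hhH (H.inv_mem (hMH.le hn))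
          rw [incl_neg] at this
          simpa using this
        · rw [incl_neg] at hn
          exact (M.mul_mem_cancel_left (M.inv_mem ((hMi n).2 hnψ))).1 hn
    rw [eq_top_iff]
    intro g _
    obtain ⟨n, hn, -⟩ := hfact g
    rw [incl_neg] at hn
    exact (H.mul_mem_cancel_left (H.inv_mem ((hL n).2 (hLtop ▸ trivial)))).1 (hMH.le hn)
  · rw [← card_quotient_eq_index (K := ψ.ker.toAddSubgroup) (by simpa using hMi) fun g => by
      obtain ⟨n, hn, -⟩ := hfact g
      exact ⟨n, _, hn, by rw [incl_neg, mul_inv_cancel_left]⟩]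
    exact Nat.card_congr (ψ.quotKerEquivOfSurjective hψ).toEquiv
  · intro n
    rw [hM, map_mul, Equiv.Perm.mul_apply, hρi, hρg, smul_zero, zero_add]

end Module

section Count

variable {N : Type*} [AddCommGroup N] [Module ℤ[X] N]

theorem exists_monic_smul_eq_zero [Module.Finite ℤ N] :
    ∃ χ : ℤ[X], χ.Monic ∧ ∀ n : N, χ • n = 0 := by
  obtain ⟨χ, hχ, h⟩ := Algebra.IsIntegral.isIntegral (R := ℤ)
    (Algebra.lsmul ℤ ℤ N (X : ℤ[X]) : Module.End ℤ N)
  refine ⟨χ, hχ, fun n => ?_⟩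
  rw [← Polynomial.aeval_def, Polynomial.aeval_algHom_apply, Polynomial.aeval_X_left_apply] at h
  exact LinearMap.congr_fun h n

/-- There are at most `deg χ` maximal ideals of `ℤ[x]` with residue field of order `n`
containing a given monic polynomial `χ`. -/
theorem card_maximal_le {χ : ℤ[X]} (hχ : χ.Monic) {n : ℕ} (hn : n ≠ 0) :
    Finite {I : Ideal ℤ[X] // I.IsMaximal ∧ χ ∈ I ∧ Nat.card (ℤ[X] ⧸ I) = n} ∧
    Nat.card {I : Ideal ℤ[X] // I.IsMaximal ∧ χ ∈ I ∧ Nat.card (ℤ[X] ⧸ I) = n} ≤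
      χ.natDegree := by
  classical
  set T := {I : Ideal ℤ[X] // I.IsMaximal ∧ χ ∈ I ∧ Nat.card (ℤ[X] ⧸ I) = n}
  rcases isEmpty_or_nonempty T with hT | ⟨⟨I₀, hI₀, -, hc₀⟩⟩
  · exact ⟨inferInstance, by simp⟩
  let := Ideal.Quotient.field I₀
  have hiso : ∀ I : T, ∃ φ : ℤ[X] →+* (ℤ[X] ⧸ I₀), RingHom.ker φ = I.1 := by
    rintro ⟨I, hI, -, hc⟩
    let := Ideal.Quotient.field I
    have : Finite (ℤ[X] ⧸ I) := Nat.finite_of_card_ne_zero (hc ▸ hn)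
    have : Finite (ℤ[X] ⧸ I₀) := Nat.finite_of_card_ne_zero (hc₀ ▸ hn)
    have := Fintype.ofFinite (ℤ[X] ⧸ I)
    have := Fintype.ofFinite (ℤ[X] ⧸ I₀)
    let σ : (ℤ[X] ⧸ I) ≃+* (ℤ[X] ⧸ I₀) := FiniteField.ringEquivOfCardEq (by
      rw [← Nat.card_eq_fintype_card, ← Nat.card_eq_fintype_card, hc, hc₀])
    refine ⟨(σ : (ℤ[X] ⧸ I) →+* (ℤ[X] ⧸ I₀)).comp (Ideal.Quotient.mk I), ?_⟩
    ext f
    simp [RingHom.mem_ker, Ideal.Quotient.eq_zero_iff_mem]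
  choose φ hφ using hiso
  let Z := (χ.map (Int.castRingHom (ℤ[X] ⧸ I₀))).roots.toFinset
  have hZ : ∀ I, φ I X ∈ Z := by
    intro I
    rw [Multiset.mem_toFinset, Polynomial.mem_roots (hχ.map _).ne_zero, Polynomial.IsRoot,
      Polynomial.eval_map]
    have h : φ I χ = 0 := by rw [← RingHom.mem_ker, hφ]; exact I.2.2.1
    rw [← h]
    conv_rhs => rw [← Polynomial.eval₂_C_X (p := χ), Polynomial.hom_eval₂]
    congr 1
    exact RingHom.ext_int _ _
  have hinj : Function.Injective fun I => (⟨φ I X, hZ I⟩ : Z) := by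
    intro I I' h
    have : φ I = φ I' := Polynomial.ringHom_ext' (RingHom.ext_int _ _) (congrArg Subtype.val h)
    exact Subtype.ext (by rw [← hφ I, ← hφ I', this])
  refine ⟨Finite.of_injective _ hinj, (Nat.card_le_card_of_injective _ hinj).trans ?_⟩
  rw [Nat.card_eq_fintype_card, Fintype.card_coe]
  exact (Multiset.toFinset_card_le _).trans
    ((Polynomial.card_roots' _).trans Polynomial.natDegree_map_le)

variable {θ : N ≃+ N} {d : ℕ}

/-- The maximal subgroup `M` is encoded by the index `i` of a vector `e i ∉ M`, the annihilator `I`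
of `e i` modulo `M ∩ N`, and the coordinates `r` with respect to `e i` of the other vectors `e j`
and of the generator of `ℤ`. -/
def IsEncodedBy (e : Fin d → N) (M : Subgroup (abelianByZ N θ)) (i : Fin d) (I : Ideal ℤ[X])
    (r : Fin d → ℤ[X]) : Prop :=
  ∃ (K : Submodule ℤ[X] N) (a : N), (∀ n, incl θ n ∈ M ↔ n ∈ K) ∧ (∀ f, f ∈ I ↔ f • e i ∈ K) ∧
    (∀ n, ∃ w : ℤ[X], n - w • e i ∈ K) ∧ (∀ j, j ≠ i → e j - r j • e i ∈ K) ∧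
    incl θ a * gen θ ∈ M ∧ a - r i • e i ∈ K

theorem IsEncodedBy.le {e : Fin d → N} {M M' : Subgroup (abelianByZ N θ)} {i : Fin d}
    {I : Ideal ℤ[X]} {r r' : Fin d → ℤ[X]} (h : IsEncodedBy e M i I r)
    (h' : IsEncodedBy e M' i I r') (hI : I.IsMaximal) (hr : ∀ j, r j - r' j ∈ I)
    {s : ℤ[X]} (hs : s ∉ I) (hsE : ∀ n : N, s • n ∈ Submodule.span ℤ[X] (Set.range e)) :
    M ≤ M' := by
  obtain ⟨K, a, hK, hIK, -, he, ha, har⟩ := h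
  obtain ⟨K', a', hK', hIK', hw', he', ha', har'⟩ := h'
  have comb : ∀ (L : Submodule ℤ[X] N) (r : Fin d → ℤ[X]), (∀ f, f ∈ I ↔ f • e i ∈ L) →
      (∀ j, j ≠ i → e j - r j • e i ∈ L) → ∀ f : Fin d → ℤ[X],
      (∑ j, f j • e j ∈ L ↔ ∑ j, f j * Function.update r i 1 j ∈ I) := by
    intro L r hIL heL f
    have key : ∑ j, f j • e j - (∑ j, f j * Function.update r i 1 j) • e i ∈ L := by
      rw [Finset.sum_smul, ← Finset.sum_sub_distrib]
      refine L.sum_mem fun j _ => ?_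
      rw [mul_smul, ← smul_sub]
      refine L.smul_mem _ ?_
      by_cases hj : j = i
      · subst hj; simp
      · simpa [hj] using heL j hj
    rw [hIL]
    exact ⟨fun h => by simpa using L.sub_mem h key, fun h => by simpa using L.add_mem key h⟩
  have hprime : ∀ n, s • n ∈ K' → n ∈ K' := by
    intro n hn
    obtain ⟨u, hu⟩ := Ideal.Quotient.exists_inv (I := I) (a := Ideal.Quotient.mk I s)
      (by rwa [Ne, Ideal.Quotient.eq_zero_iff_mem])
    obtain ⟨u, rfl⟩ := Ideal.Quotient.mk_surjective u
    rw [← map_mul, ← map_one (Ideal.Quotient.mk I), Ideal.Quotient.eq] at hu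
    obtain ⟨w, hw⟩ := hw' n
    have h1 : (s * u - 1) • n ∈ K' := by
      have := K'.add_mem (K'.smul_mem (s * u - 1) hw) (K'.smul_mem w ((hIK' _).1 hu))
      rwa [smul_comm w, ← smul_add, sub_add_cancel] at this
    rw [sub_smul, one_smul, mul_comm, mul_smul] at h1
    exact (K'.sub_mem_iff_right (K'.smul_mem u hn)).1 h1
  have hKK' : ∀ n, n ∈ K → n ∈ K' := by
    intro n hn
    apply hprime
    obtain ⟨f, hf⟩ := (Submodule.mem_span_range_iff_exists_fun _).1 (hsE n)
    rw [← hf, comb K' r' hIK' he']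
    have h1 : s • n ∈ K := K.smul_mem s hn
    rw [← hf, comb K r hIK he] at h1
    rw [← I.sub_mem_iff_right h1, ← Finset.sum_sub_distrib]
    refine I.sum_mem fun j _ => ?_
    rw [← mul_sub]
    refine I.mul_mem_left _ ?_
    by_cases hj : j = i
    · subst hj; simp
    · simpa [hj] using hr j
  refine le_of_incl_mem (fun n hn => (hK' n).2 (hKK' n ((hK n).1 hn))) ha ?_
  have h1 : a - a' ∈ K' := by
    have h2 := K'.add_mem (K'.sub_mem (hKK' _ har) har') ((hIK' _).1 (hr i))
    rw [sub_smul] at h2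
    convert h2 using 1
    abel
  have := M'.mul_mem ((hK' _).2 h1) ha'
  rwa [← mul_assoc, ← incl_add, sub_add_cancel] at this

theorem exists_isEncodedBy (hX : ∀ n : N, (X : ℤ[X]) • n = θ n) [Module.Finite ℤ[X] N]
    {χ : ℤ[X]} (hχ : ∀ n : N, χ • n = 0) {e : Fin d → N}
    [Finite (ℤ[X] ⧸ Module.annihilator ℤ[X] (N ⧸ Submodule.span ℤ[X] (Set.range e)))]
    {M : Subgroup (abelianByZ N θ)} (hM : IsCoatom M) (hN : ∃ n, incl θ n ∉ M)
    (hcard : Nat.card (ℤ[X] ⧸ Module.annihilator ℤ[X] (N ⧸ Submodule.span ℤ[X] (Set.range e))) <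
      M.index) :
    ∃ (i : Fin d) (I : Ideal ℤ[X]) (r : Fin d → ℤ[X]), IsEncodedBy e M i I r ∧ I.IsMaximal ∧
      χ ∈ I ∧ Nat.card (ℤ[X] ⧸ I) = M.index ∧
      ¬ Module.annihilator ℤ[X] (N ⧸ Submodule.span ℤ[X] (Set.range e)) ≤ I := by
  obtain ⟨K, a, hKc, hK, ha, hKM⟩ := exists_submodule_of_isCoatom hX hM hN
  have hsimple : IsSimpleModule ℤ[X] (N ⧸ K) := isSimpleModule_iff_isCoatom.2 hKc
  set J := Module.annihilator ℤ[X] (N ⧸ Submodule.span ℤ[X] (Set.range e)) with hJ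
  have general : ∀ x : N, x ∉ K → ∃ I : Ideal ℤ[X], (∀ f, f ∈ I ↔ f • x ∈ K) ∧
      (∀ n, ∃ w : ℤ[X], n - w • x ∈ K) ∧ I.IsMaximal ∧ χ ∈ I ∧
      Nat.card (ℤ[X] ⧸ I) = M.index ∧ ¬ J ≤ I := by
    intro x hx
    have hx0 : (Submodule.Quotient.mk x : N ⧸ K) ≠ 0 := by
      rwa [Ne, Submodule.Quotient.mk_eq_zero]
    have hsurj := IsSimpleModule.toSpanSingleton_surjective ℤ[X] hx0
    have hmem : ∀ f, f ∈ (LinearMap.toSpanSingleton ℤ[X] (N ⧸ K) (Submodule.Quotient.mk x)).ker ↔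
        f • x ∈ K := by
      intro f
      rw [LinearMap.mem_ker, LinearMap.toSpanSingleton_apply, ← Submodule.Quotient.mk_smul,
        Submodule.Quotient.mk_eq_zero]
    have hcardI : Nat.card (ℤ[X] ⧸ (LinearMap.toSpanSingleton ℤ[X] (N ⧸ K)
        (Submodule.Quotient.mk x)).ker) = M.index := by
      rw [← hKM]
      exact Nat.card_congr (LinearMap.quotKerEquivOfSurjective _ hsurj).toEquiv
    refine ⟨_, hmem, ?_, IsSimpleModule.ker_toSpanSingleton_isMaximal ℤ[X] hx0, ?_, hcardI, ?_⟩
    · intro n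
      obtain ⟨w, hw⟩ := hsurj (Submodule.Quotient.mk n)
      refine ⟨w, ?_⟩
      rw [LinearMap.toSpanSingleton_apply, ← Submodule.Quotient.mk_smul] at hw
      exact (Submodule.Quotient.eq _).1 hw.symm
    · rw [hmem, hχ]; exact K.zero_mem
    · intro hle
      refine hcard.not_ge ?_
      rw [← hcardI]
      exact Nat.card_le_card_of_surjective _ (Ideal.Quotient.factor_surjective hle)
  have hi : ∃ i, e i ∉ K := by
    by_contra! hcon
    have hle : Submodule.span ℤ[X] (Set.range e) ≤ K :=
      Submodule.span_le.2 (Set.range_subset_iff.2 hcon)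
    obtain ⟨x, hx⟩ : ∃ x, x ∉ K := by
      by_contra! h
      exact hKc.1 (eq_top_iff.2 fun n _ => h n)
    obtain ⟨I, hI, -, -, -, -, hJI⟩ := general x hx
    refine hJI fun f hf => (hI f).2 (hle ?_)
    rw [← Submodule.Quotient.mk_eq_zero, Submodule.Quotient.mk_smul]
    exact Module.mem_annihilator.1 hf _
  obtain ⟨i, hi⟩ := hi
  obtain ⟨I, hI, hw, hmax, hχI, hcI, hJI⟩ := general _ hi
  choose w hw' using hw
  exact ⟨i, I, Function.update (fun j => w (e j)) i (w a), ⟨K, a, hK, hI, fun n => ⟨w n, hw' n⟩,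
    fun j hj => by simpa [hj] using hw' (e j), ha, by simpa using hw' a⟩, hmax, hχI, hcI, hJI⟩

theorem finite_quotient_annihilator [Module.Finite ℤ N] {E : Submodule ℤ[X] N}
    (hE : ∀ n : N, ∃ c : ℤ, c ≠ 0 ∧ c • n ∈ E) :
    Finite (ℤ[X] ⧸ Module.annihilator ℤ[X] (N ⧸ E)) := by
  have : Finite (N ⧸ E) := by
    have : Module.Finite ℤ (N ⧸ E) := Module.Finite.of_surjective
      (E.mkQ.restrictScalars ℤ) E.mkQ_surjective
    refine Module.finite_of_fg_torsion _ ?_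
    intro x
    obtain ⟨n, rfl⟩ := E.mkQ_surjective x
    obtain ⟨c, hc, h⟩ := hE n
    refine ⟨⟨c, mem_nonZeroDivisors_of_ne_zero hc⟩, ?_⟩
    change c • E.mkQ n = 0
    rw [← map_zsmul]
    exact (Submodule.Quotient.mk_eq_zero _).2 h
  have : Finite (AddMonoid.End (N ⧸ E)) := DFunLike.finite _
  exact Finite.of_injective _ (RingHom.kerLift_injective (Module.toAddMonoidEnd ℤ[X] (N ⧸ E)))

/-- Polynomial upper bound for the number of maximal subgroups. -/
theorem exists_maxSubgroupCount_le (hX : ∀ n : N, (X : ℤ[X]) • n = θ n) [Module.Finite ℤ N]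
    {e : Fin d → N}
    (he : ∀ n : N, ∃ c : ℤ, c ≠ 0 ∧ c • n ∈ Submodule.span ℤ[X] (Set.range e)) :
    ∃ B D : ℕ, ∀ n, B < n →
      Finite {H : Subgroup (abelianByZ N θ) // IsCoatom H ∧ H.index = n} ∧
      maxSubgroupCount (abelianByZ N θ) n ≤ 1 + D * n ^ d := by
  have : Module.Finite ℤ[X] N := Module.Finite.of_restrictScalars_finite ℤ _ _
  obtain ⟨χ, hχ, hχN⟩ := exists_monic_smul_eq_zero (N := N)
  have hfin := finite_quotient_annihilator he
  set J := Module.annihilator ℤ[X] (N ⧸ Submodule.span ℤ[X] (Set.range e)) with hJ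
  refine ⟨Nat.card (ℤ[X] ⧸ J), d * χ.natDegree, fun n hn => ?_⟩
  have hn0 : n ≠ 0 := (Nat.zero_le _).trans_lt hn |>.ne'
  obtain ⟨hTf, hTc⟩ := card_maximal_le hχ hn0
  set T := {I : Ideal ℤ[X] // I.IsMaximal ∧ χ ∈ I ∧ Nat.card (ℤ[X] ⧸ I) = n}
  have hIf : ∀ I : T, Finite (ℤ[X] ⧸ I.1) := fun I =>
    Nat.finite_of_card_ne_zero (I.2.2.2.trans_ne hn0)
  let Code := Option (Fin d × (I : T) × (Fin d → ℤ[X] ⧸ I.1))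
  have hCf : Finite Code := inferInstance
  have hC : Nat.card Code ≤ 1 + d * χ.natDegree * n ^ d := by
    have h1 : Nat.card ((I : T) × (Fin d → ℤ[X] ⧸ I.1)) = Nat.card T * n ^ d := by
      have := Fintype.ofFinite T
      rw [Nat.card_sigma]
      simp only [Nat.card_fun, Nat.card_eq_fintype_card (α := Fin d), Fintype.card_fin]
      rw [Finset.sum_congr rfl fun I _ => by rw [I.2.2.2], Finset.sum_const, Finset.card_univ,
        Nat.card_eq_fintype_card, smul_eq_mul]
    rw [Finite.card_option, Nat.card_prod, h1, Nat.card_eq_fintype_card (α := Fin d),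
      Fintype.card_fin, add_comm, mul_assoc]
    gcongr
  let P : {H : Subgroup (abelianByZ N θ) // IsCoatom H ∧ H.index = n} → Code → Prop
    | M, none => ∀ n, incl θ n ∈ M.1
    | M, some (i, ⟨I, r⟩) => ¬ J ≤ I.1 ∧ ∃ r' : Fin d → ℤ[X],
        (∀ j, Ideal.Quotient.mk I.1 (r' j) = r j) ∧ IsEncodedBy e M.1 i I.1 r'
  have hP : ∀ M, ∃ c, P M c := by
    rintro ⟨M, hM, rfl⟩
    by_cases h : ∃ n, incl θ n ∉ M
    · obtain ⟨i, I, r, henc, hI, hχI, hcI, hJI⟩ := exists_isEncodedBy hX hχN hM h hn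
      exact ⟨some (i, ⟨⟨I, hI, hχI, hcI⟩, fun j => Ideal.Quotient.mk I (r j)⟩),
        hJI, r, fun j => rfl, henc⟩
    · push Not at h
      exact ⟨none, h⟩
  have hPinj : ∀ M M' c, P M c → P M' c → M = M' := by
    rintro ⟨M, hM, hMn⟩ ⟨M', hM', hMn'⟩ (_ | ⟨i, I, r⟩) h h'
    · exact Subtype.ext (eq_of_range_le h h' (hMn ▸ hn0) (hMn.trans hMn'.symm))
    · obtain ⟨hJI, r₁, hr₁, h₁⟩ := h
      obtain ⟨-, r₂, hr₂, h₂⟩ := h'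
      obtain ⟨s, hsJ, hsI⟩ := SetLike.not_le_iff_exists.1 hJI
      have hsE : ∀ n : N, s • n ∈ Submodule.span ℤ[X] (Set.range e) := by
        intro n
        rw [← Submodule.Quotient.mk_eq_zero, Submodule.Quotient.mk_smul]
        exact Module.mem_annihilator.1 hsJ _
      have hle := h₁.le h₂ I.2.1
        (fun j => Ideal.Quotient.eq.1 ((hr₁ j).trans (hr₂ j).symm)) hsI hsE
      exact Subtype.ext ((hM.le_iff_eq hM'.1).1 hle).symm
  choose F hF using hP
  have hFinj : Function.Injective F := fun M M' h => hPinj M M' _ (hF M) (h ▸ hF M')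
  exact ⟨Finite.of_injective F hFinj, (Nat.card_le_card_of_injective F hFinj).trans hC⟩

end Count

section CommRing

variable {R : Type*} [CommRing R] {V : Type*} [AddCommGroup V] [Module R V]

/-- A finitely generated module over a ring, supported at finitely many maximal ideals, is
generated by `k` elements as soon as all its fibres are. -/
theorem exists_span_eq_top_of_forall_isMaximal [Module.Finite R V] {χ : R}
    (hχ : ∀ v : V, χ • v = 0) (hfin : {m : Ideal R | m.IsMaximal ∧ χ ∈ m}.Finite) {k : ℕ}
    (h : ∀ m : Ideal R, m.IsMaximal → χ ∈ m →
      ∃ w : Fin k → V, Submodule.span R (Set.range w) ⊔ m • (⊤ : Submodule R V) = ⊤) :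
    ∃ w : Fin k → V, Submodule.span R (Set.range w) = ⊤ := by
  classical
  let P := {m : Ideal R // m.IsMaximal ∧ χ ∈ m}
  have : Finite P := hfin
  have := Fintype.ofFinite P
  choose w hw using fun m : P => h m.1 m.2.1 m.2.2
  have hcop : Pairwise (Function.onFun IsCoprime fun m : P => m.1) := fun m m' hne =>
    (Ideal.isCoprime_iff_sup_eq).2 (m.2.1.coprime_of_ne m'.2.1 fun h => hne (Subtype.ext h))
  choose r hr using fun m : P =>
    Ideal.exists_forall_sub_mem_ideal hcop (fun m' => if m' = m then (1 : R) else 0)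
  refine ⟨fun i => ∑ m, r m • w m i, ?_⟩
  by_contra hne
  obtain ⟨U, hU, hle⟩ := (eq_top_or_exists_le_coatom _).resolve_left hne
  have hsimple : IsSimpleModule R (V ⧸ U) := isSimpleModule_iff_isCoatom.2 hU
  have hmax : (Module.annihilator R (V ⧸ U)).IsMaximal := IsSimpleModule.annihilator_isMaximal
  have hann : ∀ f ∈ Module.annihilator R (V ⧸ U), ∀ v, f • v ∈ U := by
    intro f hf v
    rw [← Submodule.Quotient.mk_eq_zero, Submodule.Quotient.mk_smul]
    exact Module.mem_annihilator.1 hf _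
  have hχm : χ ∈ Module.annihilator R (V ⧸ U) := by
    rw [Module.mem_annihilator]
    intro x
    obtain ⟨v, rfl⟩ := U.mkQ_surjective x
    rw [← map_smul, hχ, map_zero]
  let m : P := ⟨_, hmax, hχm⟩
  refine hU.1 (eq_top_iff.2 ?_)
  rw [← hw m]
  refine sup_le (Submodule.span_le.2 ?_) (Submodule.smul_le.2 fun f hf v _ => hann f hf v)
  rintro _ ⟨i, rfl⟩
  have h1 : ∑ m', r m' • w m' i ∈ U := hle (Submodule.subset_span ⟨i, rfl⟩)
  have h2 : ∑ m', r m' • w m' i - w m i ∈ U := by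
    have : w m i = ∑ m', (if m = m' then (1 : R) else 0) • w m' i := by
      rw [Finset.sum_eq_single m (fun b _ hb => by rw [if_neg hb.symm, zero_smul])
        (fun h => absurd (Finset.mem_univ m) h), if_pos rfl, one_smul]
    rw [this, ← Finset.sum_sub_distrib]
    refine U.sum_mem fun m' _ => ?_
    rw [← sub_smul]
    exact hann _ (hr m' m) _
  exact (U.sub_mem_iff_right h1).1 h2

theorem exists_surjective_of_span_sup_ne_top [Module.Finite R V] {I : Ideal R} (hI : I.IsMaximal)
    {k : ℕ} (h : ∀ w : Fin k → V,
      Submodule.span R (Set.range w) ⊔ I • (⊤ : Submodule R V) ≠ ⊤) :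
    ∃ Φ : V →ₗ[R] (Fin (k + 1) → R ⧸ I), Function.Surjective Φ := by
  let _ := Ideal.Quotient.field I
  let U := V ⧸ (I • (⊤ : Submodule R V))
  have : Module.Finite (R ⧸ I) U := Module.Finite.of_restrictScalars_finite R _ _
  let b := Module.finBasis (R ⧸ I) U
  rcases lt_or_ge k (Module.finrank (R ⧸ I) U) with hk | hk
  · let Ψ : U →ₗ[R ⧸ I] (Fin (k + 1) → R ⧸ I) :=
      LinearMap.funLeft (R ⧸ I) (R ⧸ I) (Fin.castLE hk) ∘ₗ b.equivFun.toLinearMap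
    have hΨ : Function.Surjective Ψ :=
      (LinearMap.funLeft_surjective_of_injective (R ⧸ I) (R ⧸ I) _ (Fin.castLE_injective hk)).comp
        b.equivFun.surjective
    exact ⟨Ψ.restrictScalars R ∘ₗ Submodule.mkQ _, hΨ.comp (Submodule.mkQ_surjective _)⟩
  · exfalso
    choose v hv using fun i => Submodule.mkQ_surjective (I • (⊤ : Submodule R V)) (b i)
    let w : Fin k → V := fun j => if hj : j.1 < Module.finrank (R ⧸ I) U then v ⟨j, hj⟩ else 0
    refine h w (eq_top_iff.2 fun x _ => ?_)
    choose c hc using fun i => Ideal.Quotient.mk_surjective (b.repr (Submodule.mkQ _ x) i)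
    have hx : x - ∑ i, c i • v i ∈ I • (⊤ : Submodule R V) := by
      rw [← Submodule.Quotient.mk_eq_zero, ← Submodule.mkQ_apply, map_sub, map_sum, sub_eq_zero]
      conv_lhs => rw [← b.sum_repr (Submodule.mkQ _ x)]
      refine Finset.sum_congr rfl fun i _ => ?_
      rw [map_smul, hv, ← hc]
      rfl
    rw [← sub_add_cancel x (∑ i, c i • v i)]
    refine Submodule.add_mem _ (Submodule.mem_sup_right hx) (Submodule.mem_sup_left ?_)
    refine Submodule.sum_mem _ fun i _ => Submodule.smul_mem _ _ (Submodule.subset_span ?_)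
    exact ⟨Fin.castLE hk i, by simp [w]⟩

end CommRing

section LowerBound

variable {N : Type*} [AddCommGroup N] [Module ℤ[X] N] {θ : N ≃+ N}

theorem pow_card_le_maxSubgroupCount (hX : ∀ n : N, (X : ℤ[X]) • n = θ n)
    [Module.Finite ℤ[X] N] {I : Ideal ℤ[X]} (hI : I.IsMaximal) {k : ℕ}
    {Φ : N →ₗ[ℤ[X]] (Fin (k + 1) → ℤ[X] ⧸ I)} (hΦ : Function.Surjective Φ)
    [Finite {H : Subgroup (abelianByZ N θ) //
      IsCoatom H ∧ H.index = Nat.card (ℤ[X] ⧸ I)}] :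
    Nat.card (ℤ[X] ⧸ I) ^ (k + 1) ≤
      maxSubgroupCount (abelianByZ N θ) (Nat.card (ℤ[X] ⧸ I)) := by
  have : IsSimpleModule ℤ[X] (ℤ[X] ⧸ I) := isSimpleModule_iff_isCoatom.2 hI.out
  let ψ : (Fin k → ℤ[X] ⧸ I) → N →ₗ[ℤ[X]] (ℤ[X] ⧸ I) := fun c =>
    ((LinearMap.proj 0 + ∑ j, c j • LinearMap.proj (Fin.succ j) :
      (Fin (k + 1) → ℤ[X] ⧸ I) →ₗ[ℤ[X] ⧸ I] (ℤ[X] ⧸ I)).restrictScalars ℤ[X]) ∘ₗ Φ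
  have hψ : ∀ c n, ψ c n = Φ n 0 + ∑ j, c j * Φ n (Fin.succ j) := by
    intro c n; simp [ψ]
  have hsurj : ∀ c, Function.Surjective (ψ c) := by
    intro c y
    obtain ⟨n, hn⟩ := hΦ (Fin.cons y 0)
    exact ⟨n, by simp [hψ, hn]⟩
  choose M hM hMi hMN hMg using fun cb : (Fin k → ℤ[X] ⧸ I) × (ℤ[X] ⧸ I) =>
    exists_isCoatom_of_surjective hX (ψ cb.1) (hsurj cb.1) cb.2
  have hinj : Function.Injective fun cb => (⟨M cb, hM cb, hMi cb⟩ :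
      {H : Subgroup (abelianByZ N θ) // IsCoatom H ∧ H.index = Nat.card (ℤ[X] ⧸ I)}) := by
    rintro ⟨c, b⟩ ⟨c', b'⟩ h
    replace h : M (c, b) = M (c', b') := congrArg Subtype.val h
    have hc : c = c' := by
      ext j
      obtain ⟨n, hn⟩ := hΦ (Fin.cons (-c j) (Pi.single j 1))
      have h1 : ψ c n = 0 := by simp [hψ, hn, Pi.single_apply]
      rw [← hMN (c, b), h, hMN] at h1
      simp only [hψ, hn, Fin.cons_zero, Fin.cons_succ, Pi.single_apply, mul_ite, mul_one,
        mul_zero, Finset.sum_ite_eq', Finset.mem_univ, if_true] at h1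
      exact (neg_add_eq_zero.1 h1)
    subst hc
    obtain ⟨n, hn⟩ := hsurj c (-b)
    have h1 : ψ c n + b = 0 := by rw [hn, neg_add_cancel]
    rw [← hMg (c, b), h, hMg, hn, neg_add_eq_zero] at h1
    rw [h1]
  refine le_trans (le_of_eq ?_) (Nat.card_le_card_of_injective _ hinj)
  rw [Nat.card_prod, Nat.card_fun, Nat.card_eq_fintype_card (α := Fin k), Fintype.card_fin,
    pow_succ]

/-- Above every prime number `p` there is a maximal ideal of `ℤ[x]` containing a given prime ideal
that is integral over `ℤ`. -/
theorem exists_isMaximal_ge {𝔭 : Ideal ℤ[X]} {χ : ℤ[X]} (hχ : χ.Monic) (hχ𝔭 : χ ∈ 𝔭)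
    (h𝔭 : ∀ c : ℤ, C c ∈ 𝔭 → c = 0) {p : ℕ} (hp : p.Prime) :
    ∃ I : Ideal ℤ[X], I.IsMaximal ∧ 𝔭 ≤ I ∧ p ≤ Nat.card (ℤ[X] ⧸ I) := by
  have hfin : ∀ J : Ideal ℤ[X], χ ∈ J → Module.Finite ℤ (ℤ[X] ⧸ J) := by
    intro J hJ
    have := hχ.finite_quotient
    have hle : Ideal.span {χ} ≤ J := (Ideal.span_singleton_le_iff_mem _).2 hJ
    exact Module.Finite.of_surjective (Ideal.Quotient.factorₐ ℤ hle).toLinearMap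
      (Ideal.Quotient.factor_surjective hle)
  have := hfin 𝔭 hχ𝔭
  have hpZ : (Ideal.span {(p : ℤ)}).IsMaximal :=
    PrincipalIdealRing.isMaximal_of_irreducible (Nat.prime_iff_prime_int.1 hp).irreducible
  obtain ⟨Q, hQ, hQp⟩ := Ideal.exists_ideal_over_maximal_of_isIntegral (S := ℤ[X] ⧸ 𝔭)
    (Ideal.span {(p : ℤ)}) (by
      intro c hc
      rw [RingHom.mem_ker] at hc
      have : c = 0 := h𝔭 c (Ideal.Quotient.eq_zero_iff_mem.1 hc)
      rw [this]
      exact Ideal.zero_mem _)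
  have hI : (Q.comap (Ideal.Quotient.mk 𝔭)).IsMaximal :=
    Ideal.comap_isMaximal_of_surjective _ Ideal.Quotient.mk_surjective
  have hle : 𝔭 ≤ Q.comap (Ideal.Quotient.mk 𝔭) := by
    intro f hf
    rw [Ideal.mem_comap, Ideal.Quotient.eq_zero_iff_mem.2 hf]
    exact Q.zero_mem
  have hpI : (C (p : ℤ) : ℤ[X]) ∈ Q.comap (Ideal.Quotient.mk 𝔭) := by
    have : (p : ℤ) ∈ Q.comap (algebraMap ℤ (ℤ[X] ⧸ 𝔭)) :=
      hQp ▸ Ideal.mem_span_singleton_self _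
    exact this
  refine ⟨_, hI, hle, ?_⟩
  set I := Q.comap (Ideal.Quotient.mk 𝔭)
  have := hfin I (hle hχ𝔭)
  have hp0 : ((p : ℕ) : ℤ[X] ⧸ I) = 0 := by
    have := Ideal.Quotient.eq_zero_iff_mem.2 hpI
    simpa using this
  have : Nontrivial (ℤ[X] ⧸ I) := Ideal.Quotient.nontrivial_iff.2 hI.ne_top
  have : Finite (ℤ[X] ⧸ I) := by
    refine Module.finite_of_fg_torsion _ fun x => ?_
    refine ⟨⟨(p : ℤ), mem_nonZeroDivisors_of_ne_zero (by exact_mod_cast hp.ne_zero)⟩, ?_⟩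
    change (p : ℤ) • x = 0
    rw [← Int.cast_smul_eq_zsmul (ℤ[X] ⧸ I), Int.cast_natCast, hp0, zero_smul]
  have hord : addOrderOf (1 : ℤ[X] ⧸ I) = p := by
    have := Fact.mk hp
    refine addOrderOf_eq_prime ?_ one_ne_zero
    rw [nsmul_one, hp0]
  rw [← hord]
  exact Nat.le_of_dvd Nat.card_pos (addOrderOf_dvd_natCard _)

end LowerBound

section Rational

variable {N : Type*} [AddCommGroup N] [Module ℤ[X] N] {θ : N ≃+ N}
  {V : Type*} [AddCommGroup V] [Module ℚ[X] V] {ι : N →+ V}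

theorem map_polynomial_smul (hι : ∀ n, ι ((X : ℤ[X]) • n) = (X : ℚ[X]) • ι n) (f : ℤ[X]) (n : N) :
    ι (f • n) = f.map (Int.castRingHom ℚ) • ι n := by
  induction f using Polynomial.induction_on generalizing n with
  | C c =>
    rw [show (C c : ℤ[X]) = (c : ℤ[X]) from Polynomial.C_eq_intCast c, Int.cast_smul_eq_zsmul,
      Polynomial.map_intCast, Int.cast_smul_eq_zsmul, map_zsmul]
  | add f g hf hg => rw [add_smul, map_add, hf, hg, Polynomial.map_add, add_smul]
  | monomial k c h =>
    rw [pow_succ, ← mul_assoc, mul_smul, h, hι, Polynomial.map_mul _ (p := C c * X ^ k),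
      Polynomial.map_X, mul_smul]

theorem C_inv_smul_zsmul {c : ℤ} (hc : c ≠ 0) (v : V) : (C ((c : ℚ)⁻¹) : ℚ[X]) • c • v = v := by
  rw [← Int.cast_smul_eq_zsmul ℚ[X], ← Polynomial.C_eq_intCast, smul_smul, ← Polynomial.C_mul,
    inv_mul_cancel₀ (Int.cast_ne_zero.2 hc), Polynomial.C_1, one_smul]

theorem exists_generators_of_span_eq_top
    (hι : ∀ n, ι ((X : ℤ[X]) • n) = (X : ℚ[X]) • ι n)
    (hsurj : ∀ v, ∃ c : ℤ, c ≠ 0 ∧ ∃ n, c • v = ι n)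
    (hker : ∀ n, ι n = 0 → ∃ c : ℤ, c ≠ 0 ∧ c • n = 0) {d : ℕ} {w : Fin d → V}
    (hw : Submodule.span ℚ[X] (Set.range w) = ⊤) :
    ∃ e : Fin d → N, ∀ n : N, ∃ c : ℤ, c ≠ 0 ∧ c • n ∈ Submodule.span ℤ[X] (Set.range e) := by
  choose c hc e he using fun i => hsurj (w i)
  refine ⟨e, ?_⟩
  set E := Submodule.span ℤ[X] (Set.range e)
  have hEz : ∀ (a : ℤ) (n : N), n ∈ E → a • n ∈ E := fun a n hn =>
    E.toAddSubgroup.zsmul_mem hn a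
  have key : ∀ v : V, ∃ a : ℤ, a ≠ 0 ∧ ∃ n ∈ E, a • v = ι n := by
    intro v
    have hv : v ∈ Submodule.span ℚ[X] (Set.range w) := hw ▸ trivial
    induction hv using Submodule.span_induction with
    | mem x hx =>
      obtain ⟨i, rfl⟩ := hx
      exact ⟨c i, hc i, e i, Submodule.subset_span ⟨i, rfl⟩, he i⟩
    | zero => exact ⟨1, one_ne_zero, 0, E.zero_mem, by simp⟩
    | add x y _ _ hx hy =>
      obtain ⟨a, ha, m, hm, hxm⟩ := hx
      obtain ⟨b, hb, n, hn, hyn⟩ := hy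
      refine ⟨a * b, mul_ne_zero ha hb, b • m + a • n, E.add_mem (hEz _ _ hm) (hEz _ _ hn), ?_⟩
      rw [smul_add, map_add, map_zsmul, map_zsmul, ← hxm, ← hyn, smul_smul, smul_smul, mul_comm b a]
    | smul f x _ hx =>
      induction f using Polynomial.induction_on' with
      | add f g hf hg =>
        obtain ⟨a, ha, m, hm, hxm⟩ := hf
        obtain ⟨b, hb, n, hn, hyn⟩ := hg
        refine ⟨a * b, mul_ne_zero ha hb, b • m + a • n, E.add_mem (hEz _ _ hm) (hEz _ _ hn), ?_⟩
        rw [add_smul, smul_add, map_add, map_zsmul, map_zsmul, ← hxm, ← hyn, smul_smul, smul_smul,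
          mul_comm b a]
      | monomial k q =>
        obtain ⟨a, ha, m, hm, hxm⟩ := hx
        refine ⟨q.den * a, mul_ne_zero (by exact_mod_cast q.den_ne_zero) ha,
          (C q.num * X ^ k : ℤ[X]) • m, E.smul_mem _ hm, ?_⟩
        rw [map_polynomial_smul hι, ← hxm, ← Int.cast_smul_eq_zsmul ℚ[X],
          ← Int.cast_smul_eq_zsmul ℚ[X], smul_smul, smul_smul, ← Polynomial.C_mul_X_pow_eq_monomial]
        congr 1
        rw [Polynomial.map_mul, Polynomial.map_C, Polynomial.map_pow, Polynomial.map_X,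
          eq_intCast, ← Rat.den_mul_eq_num]
        push_cast
        simp only [Polynomial.C_mul, ← Polynomial.C_eq_natCast]
        ring
  intro n
  obtain ⟨a, ha, m, hm, h⟩ := key (ι n)
  obtain ⟨b, hb, h'⟩ := hker (a • n - m) (by rw [map_sub, map_zsmul, h, sub_self])
  refine ⟨b * a, mul_ne_zero hb ha, ?_⟩
  rw [smul_sub, sub_eq_zero, smul_smul] at h'
  rw [h']
  exact hEz _ _ hm

/-- If `V = ℚ ⊗ N` is not generated by `k` elements, then `N ⋊ ℤ` has at least `n ^ (k + 1)`
maximal subgroups of index `n` for arbitrarily large `n`. -/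
theorem exists_pow_le_maxSubgroupCount (hX : ∀ n : N, (X : ℤ[X]) • n = θ n) [Module.Finite ℤ N]
    [Module.Finite ℚ[X] V] (hι : ∀ n, ι ((X : ℤ[X]) • n) = (X : ℚ[X]) • ι n)
    (hsurj : ∀ v, ∃ c : ℤ, c ≠ 0 ∧ ∃ n, c • v = ι n) {k : ℕ}
    (hk : ∀ w : Fin k → V, Submodule.span ℚ[X] (Set.range w) ≠ ⊤) {B : ℕ}
    (hB : ∀ n, B < n → Finite {H : Subgroup (abelianByZ N θ) // IsCoatom H ∧ H.index = n}) :
    ∃ n, B < n ∧ n ^ (k + 1) ≤ maxSubgroupCount (abelianByZ N θ) n := by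
  have : Module.Finite ℤ[X] N := Module.Finite.of_restrictScalars_finite ℤ _ _
  obtain ⟨χ, hχ, hχN⟩ := exists_monic_smul_eq_zero (N := N)
  set χQ := χ.map (Int.castRingHom ℚ)
  have hχQ : χQ ≠ 0 := (hχ.map _).ne_zero
  have hχV : ∀ v : V, χQ • v = 0 := by
    intro v
    obtain ⟨c, hc, n, hn⟩ := hsurj v
    rw [← C_inv_smul_zsmul hc v, hn, smul_comm, ← map_polynomial_smul hι, hχN, map_zero, smul_zero]
  have hfin : {m : Ideal ℚ[X] | m.IsMaximal ∧ χQ ∈ m}.Finite := by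
    have hI : Ideal.span {χQ} ≠ 0 := by
      rwa [Ne, Ideal.zero_eq_bot, Ideal.span_singleton_eq_bot]
    refine ((Ideal.finite_factors hI).image fun v => v.asIdeal).subset ?_
    rintro m ⟨hm, hχm⟩
    refine ⟨⟨m, hm.isPrime, fun h => hχQ ?_⟩, ?_, rfl⟩
    · rw [h] at hχm; exact hχm
    · exact Ideal.dvd_span_singleton.2 hχm
  obtain ⟨m, hm, hχm, hmw⟩ : ∃ m : Ideal ℚ[X], m.IsMaximal ∧ χQ ∈ m ∧ ∀ w : Fin k → V,
      Submodule.span ℚ[X] (Set.range w) ⊔ m • (⊤ : Submodule ℚ[X] V) ≠ ⊤ := by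
    by_contra! hcon
    obtain ⟨w, hw⟩ := exists_span_eq_top_of_forall_isMaximal hχV hfin hcon
    exact hk w hw
  obtain ⟨p, hpB, hp⟩ := Nat.exists_infinite_primes (B + 1)
  obtain ⟨I, hI, hmI, hpI⟩ := exists_isMaximal_ge (𝔭 := m.comap (mapRingHom (Int.castRingHom ℚ)))
    hχ hχm (by
      intro c hc
      by_contra hc0
      refine hm.ne_top (Ideal.eq_top_of_isUnit_mem _ hc ?_)
      rw [coe_mapRingHom, Polynomial.map_C, Polynomial.isUnit_C]
      simpa using hc0) hp
  obtain ⟨Φ, hΦ⟩ := exists_surjective_of_span_sup_ne_top (V := N) hI (k := k) (by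
    intro w hw
    obtain ⟨r, hr, hrN⟩ := Submodule.exists_sub_one_mem_and_smul_le_of_fg_of_le_sup
      (Module.Finite.fg_top (R := ℤ[X]) (M := N)) le_rfl hw.ge
    have hrI : r ∉ I := fun h => hI.ne_top <| (Ideal.eq_top_iff_one _).2 <| by
      simpa using I.sub_mem h hr
    have hrm : r.map (Int.castRingHom ℚ) ∉ m := fun h => hrI (hmI h)
    obtain ⟨u, t, ht, hut⟩ := hm.exists_inv hrm
    refine hmw (ι ∘ w) (eq_top_iff.2 fun v _ => ?_)
    have hspan : ∀ n ∈ Submodule.span ℤ[X] (Set.range w),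
        ι n ∈ Submodule.span ℚ[X] (Set.range (ι ∘ w)) := by
      intro n hn
      induction hn using Submodule.span_induction with
      | mem x hx =>
        obtain ⟨i, rfl⟩ := hx
        exact Submodule.subset_span ⟨i, rfl⟩
      | zero => rw [map_zero]; exact Submodule.zero_mem _
      | add x y _ _ hx hy => rw [map_add]; exact Submodule.add_mem _ hx hy
      | smul f x _ hx => rw [map_polynomial_smul hι]; exact Submodule.smul_mem _ _ hx
    obtain ⟨c, hc, n, hn⟩ := hsurj v
    have hrv : r.map (Int.castRingHom ℚ) • v ∈ Submodule.span ℚ[X] (Set.range (ι ∘ w)) := by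
      rw [← C_inv_smul_zsmul hc v, hn, smul_comm, ← map_polynomial_smul hι]
      exact Submodule.smul_mem _ _
        (hspan _ (hrN (Submodule.smul_mem_pointwise_smul n r ⊤ trivial)))
    rw [← one_smul ℚ[X] v, ← hut, add_smul, mul_smul]
    exact Submodule.add_mem _ (Submodule.mem_sup_left (Submodule.smul_mem _ _ hrv))
      (Submodule.mem_sup_right (Submodule.smul_mem_smul ht trivial)))
  have hlt : B < Nat.card (ℤ[X] ⧸ I) := lt_of_lt_of_le hpB hpI
  have := hB _ hlt
  exact ⟨_, hlt, pow_card_le_maxSubgroupCount hX hI hΦ⟩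

end Rational

theorem limsup_log_div_log_eq {u : ℕ → ℕ} {d B D : ℕ} (hle : ∀ n, B < n → u n ≤ 1 + D * n ^ d)
    (hge : ∀ b, B ≤ b → d ≠ 0 → ∃ n, b < n ∧ n ^ d ≤ u n) :
    Filter.atTop.limsup (fun n : ℕ => Real.log (u n) / Real.log n) = d := by
  have hlog : Filter.Tendsto (fun n : ℕ => Real.log n) Filter.atTop Filter.atTop :=
    Real.tendsto_log_atTop.comp tendsto_natCast_atTop_atTop
  have hlim : Filter.Tendsto (fun n : ℕ => (d : ℝ) + Real.log (1 + D) / Real.log n)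
      Filter.atTop (nhds d) := by
    simpa using tendsto_const_nhds.add (hlog.const_div_atTop (Real.log (1 + D)))
  have hub : ∀ᶠ n : ℕ in Filter.atTop,
      Real.log (u n) / Real.log n ≤ d + Real.log (1 + D) / Real.log n := by
    filter_upwards [Filter.eventually_gt_atTop (max B 1)] with n hn
    have hn1 : 1 < (n : ℝ) := by exact_mod_cast (le_max_right B 1).trans_lt hn
    have hpos : 0 < Real.log n := Real.log_pos hn1
    rw [div_le_iff₀ hpos, add_mul, div_mul_cancel₀ _ hpos.ne']
    rcases Nat.eq_zero_or_pos (u n) with h0 | h0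
    · rw [h0, Nat.cast_zero, Real.log_zero]
      have : 0 ≤ Real.log (1 + D) := Real.log_nonneg (by simp)
      positivity
    · have h1 : (u n : ℝ) ≤ (n : ℝ) ^ d * (1 + D) := by
        have h2 : (u n : ℝ) ≤ 1 + D * (n : ℝ) ^ d := by
          exact_mod_cast hle n ((le_max_left B 1).trans_lt hn)
        have h3 : 1 ≤ (n : ℝ) ^ d := one_le_pow₀ hn1.le
        linarith
      calc Real.log (u n) ≤ Real.log ((n : ℝ) ^ d * (1 + D)) :=
            Real.log_le_log (by exact_mod_cast h0) h1
        _ = _ := by rw [Real.log_mul (by positivity) (by positivity), Real.log_pow]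
  have hnonneg : ∀ n : ℕ, 0 ≤ Real.log (u n) / Real.log n := fun n =>
    div_nonneg (Real.log_natCast_nonneg _) (Real.log_natCast_nonneg _)
  have hbdd : Filter.IsBoundedUnder (· ≤ ·) Filter.atTop
      (fun n : ℕ => Real.log (u n) / Real.log n) := hlim.isBoundedUnder_le.mono_le hub
  have hcobdd : Filter.IsCoboundedUnder (· ≤ ·) Filter.atTop
      (fun n : ℕ => Real.log (u n) / Real.log n) :=
    (Filter.isBoundedUnder_of ⟨0, hnonneg⟩).isCoboundedUnder_le
  refine le_antisymm ?_ ?_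
  · rw [← hlim.limsup_eq]
    exact Filter.limsup_le_limsup hub hcobdd hlim.isBoundedUnder_le
  · refine Filter.le_limsup_of_frequently_le ?_ hbdd
    rcases eq_or_ne d 0 with rfl | hd
    · exact Filter.Frequently.of_forall fun n => by simpa using hnonneg n
    · rw [Filter.frequently_atTop]
      intro b
      obtain ⟨n, hn, h⟩ := hge (max B (max b 1)) (le_max_left _ _) hd
      have hbn : b ≤ n := ((le_max_left b 1).trans (le_max_right B _)).trans hn.le
      have h1n : 1 < n := ((le_max_right b 1).trans (le_max_right B _)).trans_lt hn
      refine ⟨n, hbn, ?_⟩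
      rw [le_div_iff₀ (Real.log_pos (by exact_mod_cast h1n)), ← Real.log_pow]
      refine Real.log_le_log (by positivity) ?_
      exact_mod_cast h

end AbelianByZ

theorem stmt1 {N : Type*} [AddCommGroup N] [AddGroup.FG N] (θ : N ≃+ N) (d : ℕ)
    -- `d` is the minimal number of generators of `ℚ ⊗_ℤ N` as a `ℚ[x]`-module,
    -- where `x` acts via `θ`
    (hd : IsLeast {k : ℕ |
      ∃ s : Finset (Module.AEval' (LinearMap.baseChange ℚ θ.toAddMonoidHom.toIntLinearMap)),
        s.card = k ∧ Submodule.span ℚ[X] (s : Set (Module.AEval'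
          (LinearMap.baseChange ℚ θ.toAddMonoidHom.toIntLinearMap))) = ⊤} d) :
    mdeg (abelianByZ N θ) = d := by
  classical
  set T : N →ₗ[ℤ] N := θ.toAddMonoidHom.toIntLinearMap
  let V := Module.AEval' (LinearMap.baseChange ℚ T)
  let _ : Module ℤ[X] N := inferInstanceAs (Module ℤ[X] (Module.AEval' T))
  have hX : ∀ n : N, (X : ℤ[X]) • n = θ n := Module.AEval'.X_smul_of T
  have : Module.Finite ℤ N := Module.Finite.iff_addGroup_fg.2 inferInstance
  let ι : N →+ V :=
    ((Module.AEval'.of (LinearMap.baseChange ℚ T)).toLinearMap.toAddMonoidHom).comp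
      (TensorProduct.mk ℤ ℚ N 1).toAddMonoidHom
  have hι : ∀ n, ι ((X : ℤ[X]) • n) = (X : ℚ[X]) • ι n := by
    intro n
    rw [hX]
    exact (Module.AEval'.X_smul_of (LinearMap.baseChange ℚ T) (1 ⊗ₜ n)).symm
  have hloc : IsLocalizedModule (nonZeroDivisors ℤ) (TensorProduct.mk ℤ ℚ N 1) :=
    (isLocalizedModule_iff_isBaseChange (nonZeroDivisors ℤ) ℚ _).2
      (TensorProduct.isBaseChange ℤ N ℚ)
  have hsurj : ∀ v : V, ∃ c : ℤ, c ≠ 0 ∧ ∃ n, c • v = ι n := by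
    intro v
    obtain ⟨⟨n, c⟩, h⟩ := IsLocalizedModule.surj (nonZeroDivisors ℤ) (TensorProduct.mk ℤ ℚ N 1)
      ((Module.AEval'.of (LinearMap.baseChange ℚ T)).symm v)
    exact ⟨c, nonZeroDivisors.coe_ne_zero c, n, h⟩
  have hker : ∀ n, ι n = 0 → ∃ c : ℤ, c ≠ 0 ∧ c • n = 0 := by
    intro n hn
    obtain ⟨c, h⟩ := (IsLocalizedModule.eq_zero_iff (nonZeroDivisors ℤ)
      (TensorProduct.mk ℤ ℚ N 1)).1 hn
    exact ⟨c, nonZeroDivisors.coe_ne_zero c, h⟩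
  obtain ⟨⟨s, rfl, hs⟩, hmin⟩ := hd
  have : Module.Finite ℚ[X] V := ⟨⟨s, hs⟩⟩
  have hw : Submodule.span ℚ[X] (Set.range fun i => ((s.equivFin.symm i : s) : V)) = ⊤ := by
    rw [← hs]
    congr 1
    ext v
    exact ⟨fun ⟨i, hi⟩ => hi ▸ (s.equivFin.symm i).2, fun hv => ⟨s.equivFin ⟨v, hv⟩, by simp⟩⟩
  obtain ⟨e, he⟩ := AbelianByZ.exists_generators_of_span_eq_top hι hsurj hker hw
  obtain ⟨B, D, hBD⟩ := AbelianByZ.exists_maxSubgroupCount_le hX he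
  refine AbelianByZ.limsup_log_div_log_eq (B := B) (D := D) (fun n hn => (hBD n hn).2) ?_
  intro b hb h0
  obtain ⟨k, hk⟩ := Nat.exists_eq_succ_of_ne_zero h0
  rw [hk]
  refine AbelianByZ.exists_pow_le_maxSubgroupCount hX hι hsurj (fun w hw => ?_)
    fun n hn => (hBD n (hb.trans_lt hn)).1
  have h1 : s.card ≤ (Finset.univ.image w).card := hmin ⟨_, rfl, by simpa using hw⟩
  have h2 : (Finset.univ.image w).card ≤ k := Finset.card_image_le.trans (by simp)
  omega
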